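/- arXiv:1801.06301 — 5 statements merged into one kernel-verified Lean document; each statement's English description precedes it below -/
import Mathlib

section
/- Let K be a field, q ∈ K with q ≠ 0, and i, j ∈ ℤ. Write {m} := q^m − q^{−m} for m ∈ ℤ. Define 4×4 matrices over K: A with rows ( {2i+2j}² − {2i}{2j}q^{−2(i+j)}, 0, 0, −{2i+2j}{2j}q^{2(i+j)} ), ( 0, {2i}², 0, 0 ), ( 0, 0, {2j}², 0 ), ( {2i}{2i+2j}, 0, 0, −{2i}{2j}q^{2(i+j)} ); and B with rows ( {2i}q^{2j}, 0, 0, −{2j}q^{2(i+j)} ), ( 0, {2i−2j}, 0, 0 ), ( 0, 0, 0, 0 ), ( {2i}, 0, 0, −{2j}q^{2i} ). Then A = {2i+2j}·B + {2j}²·1, where 1 is the 4×4 identity matrix. (This is the matrix identity underlying MOY-type relation (v) for Viro's gl(1|1)-Alexander polynomial: the morphism of the square diagram equals {2i+2j} times the morphism of the theta diagram plus {2j}² times the identity.) -/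
open Matrix

/-- `q^m − q^{−m}` for `m : ℤ`. -/
def qbr {K : Type*} [Field K] (q : K) (m : ℤ) : K := q ^ m - q ^ (-m)

theorem qbr_add {K : Type*} [Field K] {q : K} (hq : q ≠ 0) (a b : ℤ) :
    qbr q (a + b) = q ^ a * q ^ b - (q ^ a)⁻¹ * (q ^ b)⁻¹ := by
  rw [qbr, _root_.zpow_neg, zpow_add₀ hq, mul_inv]

theorem qbr_sub {K : Type*} [Field K] {q : K} (hq : q ≠ 0) (a b : ℤ) :
    qbr q (a - b) = q ^ a * (q ^ b)⁻¹ - (q ^ a)⁻¹ * q ^ b := by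
  rw [sub_eq_add_neg, qbr_add hq, _root_.zpow_neg, inv_inv]

theorem qbr_add_sq_sub {K : Type*} [Field K] {q : K} (hq : q ≠ 0) (a b : ℤ) :
    qbr q (a + b) ^ 2 - qbr q a * qbr q b * q ^ (-(a + b)) =
      qbr q (a + b) * (qbr q a * q ^ b) + qbr q b ^ 2 := by
  have ha := zpow_ne_zero a hq
  have hb := zpow_ne_zero b hq
  simp only [qbr, _root_.zpow_neg, zpow_add₀ hq]
  field_simp
  ring

theorem qbr_sq {K : Type*} [Field K] {q : K} (hq : q ≠ 0) (a b : ℤ) :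
    qbr q a ^ 2 = qbr q (a + b) * qbr q (a - b) + qbr q b ^ 2 := by
  have ha := zpow_ne_zero a hq
  have hb := zpow_ne_zero b hq
  rw [qbr_add hq, qbr_sub hq]
  simp only [qbr, _root_.zpow_neg]
  field_simp
  ring

theorem neg_qbr_mul_qbr_mul_zpow {K : Type*} [Field K] {q : K} (hq : q ≠ 0) (a b : ℤ) :
    -(qbr q a * qbr q b * q ^ (a + b)) =
      -(qbr q (a + b) * (qbr q b * q ^ a)) + qbr q b ^ 2 := by
  have ha := zpow_ne_zero a hq
  have hb := zpow_ne_zero b hq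
  simp only [qbr, _root_.zpow_neg, zpow_add₀ hq]
  field_simp
  ring

/-- The matrix identity underlying MOY-type relation (v):
`A = {2i+2j}·B + {2j}²·1`. -/
theorem moy_relation_v_matrix {K : Type*} [Field K] (q : K) (hq : q ≠ 0) (i j : ℤ)
    (A B : Matrix (Fin 4) (Fin 4) K)
    (hA : A = !![qbr q (2*i+2*j) ^ 2 - qbr q (2*i) * qbr q (2*j) * q ^ (-(2*(i+j))), 0, 0,
                  -(qbr q (2*i+2*j) * qbr q (2*j) * q ^ (2*(i+j)));
                 0, qbr q (2*i) ^ 2, 0, 0;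
                 0, 0, qbr q (2*j) ^ 2, 0;
                 qbr q (2*i) * qbr q (2*i+2*j), 0, 0,
                  -(qbr q (2*i) * qbr q (2*j) * q ^ (2*(i+j)))])
    (hB : B = !![qbr q (2*i) * q ^ (2*j), 0, 0, -(qbr q (2*j) * q ^ (2*(i+j)));
                 0, qbr q (2*i-2*j), 0, 0;
                 0, 0, 0, 0;
                 qbr q (2*i), 0, 0, -(qbr q (2*j) * q ^ (2*i))]) :
    A = qbr q (2*i+2*j) • B + qbr q (2*j) ^ 2 • (1 : Matrix (Fin 4) (Fin 4) K) := by
  subst hA hB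
  rw [mul_add 2 i j, qbr_add_sq_sub hq, qbr_sq hq (2 * i) (2 * j),
    neg_qbr_mul_qbr_mul_zpow hq]
  ext r c
  fin_cases r <;> fin_cases c <;> simp [mul_assoc, mul_comm, mul_left_comm]
end

section
/- Let K be a field, q ∈ K with q ≠ 0, and i, j, k, l ∈ ℤ. Write {m} := q^m − q^{−m} for m ∈ ℤ. Set a₂₂ = {2j−2k}{2i+2k}q^{2l} + {2k}{2l}q^{2(i−j+k)} and a₂₃ = {2i+2k−2l}{2k}q^{2(i−j+k−l)}. Define 4×4 matrices over K: A with rows ( {2j}{2i+2k}, 0, 0, 0 ), ( 0, a₂₂, a₂₃, 0 ), ( 0, {2j}{2l}, {2j}{2i+2k−2l}q^{−2l}, 0 ), ( 0, 0, 0, {2j−2k}{2i+2k−2l} ); B with rows ( {2i+2j}, 0, 0, 0 ), ( 0, {2j+2l−2k}q^{2i}, {2i+2k−2l}q^{−2(j+l−k−i)}, 0 ), ( 0, {2j+2l−2k}, {2i+2k−2l}q^{−2(j+l−k)}, 0 ), ( 0, 0, 0, 0 ); and C with rows ( {2j}, 0, 0, 0 ), ( 0, {2j+2l−2k}, {2k−2l}q^{−2(j+l−k−i)},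 0 ), ( 0, 0, {2j}, 0 ), ( 0, 0, 0, {2j+2l−2k} ). If {2j+2l−2k} ≠ 0, then A = ({2j}{2l}/{2j+2l−2k})·B + ({2i+2k−2l}{2j−2k}/{2j+2l−2k})·C. (This is the matrix identity underlying MOY-type relation (vii) for Viro's gl(1|1)-Alexander polynomial.) -/
open Matrix

/-- The matrix identity underlying MOY-type relation (vii):
if `{2j+2l−2k} ≠ 0` then
`A = ({2j}{2l}/{2j+2l−2k})·B + ({2i+2k−2l}{2j−2k}/{2j+2l−2k})·C`. -/
theorem moy_relation_vii_matrix {K : Type*} [Field K] (q : K) (hq : q ≠ 0) (i j k l : ℤ)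
    (A B C : Matrix (Fin 4) (Fin 4) K)
    (hA : A = !![qbr q (2*j) * qbr q (2*i+2*k), 0, 0, 0;
                 0, qbr q (2*j-2*k) * qbr q (2*i+2*k) * q ^ (2*l)
                    + qbr q (2*k) * qbr q (2*l) * q ^ (2*(i-j+k)),
                    qbr q (2*i+2*k-2*l) * qbr q (2*k) * q ^ (2*(i-j+k-l)), 0;
                 0, qbr q (2*j) * qbr q (2*l),
                    qbr q (2*j) * qbr q (2*i+2*k-2*l) * q ^ (-(2*l)), 0;
                 0, 0, 0, qbr q (2*j-2*k) * qbr q (2*i+2*k-2*l)])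
    (hB : B = !![qbr q (2*i+2*j), 0, 0, 0;
                 0, qbr q (2*j+2*l-2*k) * q ^ (2*i),
                    qbr q (2*i+2*k-2*l) * q ^ (-(2*(j+l-k-i))), 0;
                 0, qbr q (2*j+2*l-2*k),
                    qbr q (2*i+2*k-2*l) * q ^ (-(2*(j+l-k))), 0;
                 0, 0, 0, 0])
    (hC : C = !![qbr q (2*j), 0, 0, 0;
                 0, qbr q (2*j+2*l-2*k),
                    qbr q (2*k-2*l) * q ^ (-(2*(j+l-k-i))), 0;
                 0, 0, qbr q (2*j), 0;
                 0, 0, 0, qbr q (2*j+2*l-2*k)])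
    (hne : qbr q (2*j+2*l-2*k) ≠ 0) :
    A = (qbr q (2*j) * qbr q (2*l) / qbr q (2*j+2*l-2*k)) • B
        + (qbr q (2*i+2*k-2*l) * qbr q (2*j-2*k) / qbr q (2*j+2*l-2*k)) • C := by
  have hi := zpow_ne_zero i hq
  have hj := zpow_ne_zero j hq
  have hk := zpow_ne_zero k hq
  have hl := zpow_ne_zero l hq
  rw [hA, hB, hC, ← smul_right_inj hne, smul_add, smul_smul, smul_smul,
    mul_div_cancel₀ _ hne, mul_div_cancel₀ _ hne]
  clear hA hB hC hne
  simp only [qbr, mul_comm (2 : ℤ), neg_add, sub_eq_add_neg, neg_neg, ← neg_mul, add_mul,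
    zpow_add₀ hq, _root_.zpow_mul, _root_.zpow_neg, zpow_ofNat]
  generalize q ^ i = x at *
  generalize q ^ j = y at *
  generalize q ^ k = z at *
  generalize q ^ l = w at *
  ext a b
  fin_cases a <;> fin_cases b <;> simp <;> field_simp <;> ring
end

section
/- Let K be a field, q ∈ K with q ≠ 0, and i, j, k, l ∈ ℤ. Write {m} := q^m − q^{−m} for m ∈ ℤ. With A, B, C the 4×4 matrices over K defined as follows: A has rows ( {2j}{2i+2k}, 0, 0, 0 ), ( 0, {2j−2k}{2i+2k}q^{2l} + {2k}{2l}q^{2(i−j+k)}, {2i+2k−2l}{2k}q^{2(i−j+k−l)}, 0 ), ( 0, {2j}{2l}, {2j}{2i+2k−2l}q^{−2l}, 0 ), ( 0, 0, 0, {2j−2k}{2i+2k−2l} ); B has rows ( {2i+2j}, 0, 0, 0 ), ( 0, {2j+2l−2k}q^{2i}, {2i+2k−2l}q^{−2(j+l−k−i)}, 0 ), ( 0, {2j+2l−2k}, {2i+2k−2l}q^{−2(j+l−k)}, 0 ), ( 0, 0, 0, 0 ); C has rows ( {2j}, 0, 0, 0 ), ( 0, {2j+2l−2k}, {2k−2l}q^{−2(j+l−k−i)},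 0 ), ( 0, 0, {2j}, 0 ), ( 0, 0, 0, {2j+2l−2k} ). Then, with no nonvanishing hypothesis, the denominator-cleared identity holds: {2j+2l−2k}·A = {2j}{2l}·B + {2i+2k−2l}{2j−2k}·C. -/
open Matrix

/-- The denominator-cleared matrix identity underlying MOY-type relation (vii):
`{2j+2l−2k}·A = {2j}{2l}·B + {2i+2k−2l}{2j−2k}·C`. -/
theorem moy_relation_vii_matrix_cleared {K : Type*} [Field K] (q : K) (hq : q ≠ 0)
    (i j k l : ℤ) (A B C : Matrix (Fin 4) (Fin 4) K)
    (hA : A = !![qbr q (2*j) * qbr q (2*i+2*k), 0, 0, 0;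
                 0, qbr q (2*j-2*k) * qbr q (2*i+2*k) * q ^ (2*l)
                    + qbr q (2*k) * qbr q (2*l) * q ^ (2*(i-j+k)),
                    qbr q (2*i+2*k-2*l) * qbr q (2*k) * q ^ (2*(i-j+k-l)), 0;
                 0, qbr q (2*j) * qbr q (2*l),
                    qbr q (2*j) * qbr q (2*i+2*k-2*l) * q ^ (-(2*l)), 0;
                 0, 0, 0, qbr q (2*j-2*k) * qbr q (2*i+2*k-2*l)])
    (hB : B = !![qbr q (2*i+2*j), 0, 0, 0;
                 0, qbr q (2*j+2*l-2*k) * q ^ (2*i),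
                    qbr q (2*i+2*k-2*l) * q ^ (-(2*(j+l-k-i))), 0;
                 0, qbr q (2*j+2*l-2*k),
                    qbr q (2*i+2*k-2*l) * q ^ (-(2*(j+l-k))), 0;
                 0, 0, 0, 0])
    (hC : C = !![qbr q (2*j), 0, 0, 0;
                 0, qbr q (2*j+2*l-2*k),
                    qbr q (2*k-2*l) * q ^ (-(2*(j+l-k-i))), 0;
                 0, 0, qbr q (2*j), 0;
                 0, 0, 0, qbr q (2*j+2*l-2*k)]) :
    qbr q (2*j+2*l-2*k) • A =
      (qbr q (2*j) * qbr q (2*l)) • B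
        + (qbr q (2*i+2*k-2*l) * qbr q (2*j-2*k)) • C := by
  subst hA hB hC
  have e2 (m : ℤ) : q ^ (2 * m) = (q ^ m) ^ 2 := by rw [mul_comm, _root_.zpow_mul]; norm_cast
  have hi := zpow_ne_zero i hq
  have hj := zpow_ne_zero j hq
  have hk := zpow_ne_zero k hq
  have hl := zpow_ne_zero l hq
  ext r s
  fin_cases r <;> fin_cases s <;>
    simp [qbr, zpow_add₀ hq, zpow_sub₀ hq, _root_.zpow_neg, e2] <;>
    field_simp <;> ring
end

section
/- Let K be a field, q ∈ K with q ≠ 0, and i, j, I, J ∈ ℤ. Write {m} := q^m − q^{−m} for m ∈ ℤ. Define 4×4 matrices over K: A with rows ( q^{i+j−iJ−jI}, 0, 0, 0 ), ( 0, (q^{4i}−1)·q^{−(i+j+iJ+jI)}, q^{j−i−iJ−jI}, 0 ), ( 0, q^{i−j−iJ−jI}, 0, 0 ), ( 0, 0, 0, −q^{−i−j−iJ−jI} ); B with rows ( {2i+2j}, 0, 0, 0 ), ( 0, {2i}q^{2i}, {2j}, 0 ), ( 0, {2i}, {2j}q^{−2i}, 0 ), ( 0, 0, 0, 0 ); and C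 with rows ( {2j}, 0, 0, 0 ), ( 0, {2i}, {2j−2i}, 0 ), ( 0, 0, {2j}, 0 ), ( 0, 0, 0, {2i} ). If {2i} ≠ 0, then A = (q^{i−j−iJ−jI}/{2i})·B + (−q^{−i−j−iJ−jI}/{2i})·C. (This is the matrix identity underlying the first equality of MOY-type relation (viii), expressing the positive crossing as a linear combination of the theta diagram and the single-rung diagram.) -/
open Matrix

/-- The matrix identity underlying the first equality of MOY-type relation (viii):
if `{2i} ≠ 0` then `A = (q^{i−j−iJ−jI}/{2i})·B + (−q^{−i−j−iJ−jI}/{2i})·C`. -/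
theorem moy_relation_viii_matrix {K : Type*} [Field K] (q : K) (hq : q ≠ 0)
    (i j I J : ℤ) (A B C : Matrix (Fin 4) (Fin 4) K)
    (hA : A = !![q ^ (i+j-i*J-j*I), 0, 0, 0;
                 0, (q ^ (4*i) - 1) * q ^ (-(i+j+i*J+j*I)), q ^ (j-i-i*J-j*I), 0;
                 0, q ^ (i-j-i*J-j*I), 0, 0;
                 0, 0, 0, -q ^ (-i-j-i*J-j*I)])
    (hB : B = !![qbr q (2*i+2*j), 0, 0, 0;
                 0, qbr q (2*i) * q ^ (2*i), qbr q (2*j), 0;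
                 0, qbr q (2*i), qbr q (2*j) * q ^ (-(2*i)), 0;
                 0, 0, 0, 0])
    (hC : C = !![qbr q (2*j), 0, 0, 0;
                 0, qbr q (2*i), qbr q (2*j-2*i), 0;
                 0, 0, qbr q (2*j), 0;
                 0, 0, 0, qbr q (2*i)])
    (hne : qbr q (2*i) ≠ 0) :
    A = (q ^ (i-j-i*J-j*I) / qbr q (2*i)) • B
        + (-q ^ (-i-j-i*J-j*I) / qbr q (2*i)) • C := by
  have h_four : q ^ (4*i) = (q ^ i) ^ 4 := by rw [mul_comm, _root_.zpow_mul]; norm_cast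
  have h_two (m : ℤ) : q ^ (2*m) = (q ^ m) ^ 2 := by rw [mul_comm, _root_.zpow_mul]; norm_cast
  subst hA hB hC
  simp only [qbr, neg_add, neg_neg, sub_eq_add_neg, zpow_add₀ hq, _root_.zpow_neg, h_two,
    h_four] at hne ⊢
  have hi : q ^ i ≠ 0 := zpow_ne_zero i hq
  have hj : q ^ j ≠ 0 := zpow_ne_zero j hq
  have hiJ : q ^ (i*J) ≠ 0 := zpow_ne_zero _ hq
  have hjI : q ^ (j*I) ≠ 0 := zpow_ne_zero _ hq
  generalize q ^ i = a at *
  generalize q ^ j = b at *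
  generalize q ^ (i*J) = u at *
  generalize q ^ (j*I) = v at *
  generalize hd : a ^ 2 + -(a ^ 2)⁻¹ = d at *
  ext r s
  fin_cases r <;> fin_cases s <;> simp <;> field_simp <;> subst hd <;> try (field_simp; ring)
end

section
/- Let K be a field, q ∈ K with q ≠ 0, and i, j, I, J ∈ ℤ. Write {m} := q^m − q^{−m} for m ∈ ℤ. With A, B, C the 4×4 matrices over K defined as follows: A has rows ( q^{i+j−iJ−jI}, 0, 0, 0 ), ( 0, (q^{4i}−1)·q^{−(i+j+iJ+jI)}, q^{j−i−iJ−jI}, 0 ), ( 0, q^{i−j−iJ−jI}, 0, 0 ), ( 0, 0, 0, −q^{−i−j−iJ−jI} ); B has rows ( {2i+2j}, 0, 0, 0 ), ( 0, {2i}q^{2i}, {2j}, 0 ), ( 0, {2i}, {2j}q^{−2i}, 0 ), ( 0, 0, 0, 0 ); C has rows ( {2j}, 0, 0, 0 ), ( 0, {2i}, {2j−2i}, 0 ), ( 0, 0, {2j}, 0 ), ( 0, 0, 0, {2i} ). Then, with no nonvanishing hypothesis, the denominator-cleared identity holds: {2i}·A = q^{i−j−iJ−jI}·B − q^{−i−j−iJ−jI}·C.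 -/
open Matrix

/-- The denominator-cleared matrix identity underlying the first equality of
MOY-type relation (viii): `{2i}·A = q^{i−j−iJ−jI}·B − q^{−i−j−iJ−jI}·C`. -/
theorem moy_relation_viii_matrix_cleared {K : Type*} [Field K] (q : K) (hq : q ≠ 0)
    (i j I J : ℤ) (A B C : Matrix (Fin 4) (Fin 4) K)
    (hA : A = !![q ^ (i+j-i*J-j*I), 0, 0, 0;
                 0, (q ^ (4*i) - 1) * q ^ (-(i+j+i*J+j*I)), q ^ (j-i-i*J-j*I), 0;
                 0, q ^ (i-j-i*J-j*I), 0, 0;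
                 0, 0, 0, -q ^ (-i-j-i*J-j*I)])
    (hB : B = !![qbr q (2*i+2*j), 0, 0, 0;
                 0, qbr q (2*i) * q ^ (2*i), qbr q (2*j), 0;
                 0, qbr q (2*i), qbr q (2*j) * q ^ (-(2*i)), 0;
                 0, 0, 0, 0])
    (hC : C = !![qbr q (2*j), 0, 0, 0;
                 0, qbr q (2*i), qbr q (2*j-2*i), 0;
                 0, 0, qbr q (2*j), 0;
                 0, 0, 0, qbr q (2*i)]) :
    qbr q (2*i) • A = q ^ (i-j-i*J-j*I) • B - q ^ (-i-j-i*J-j*I) • C := by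
  subst hA hB hC
  ext r s
  fin_cases r <;> fin_cases s <;>
    simp [-_root_.zpow_neg] <;>
    simp only [qbr, sub_mul, mul_sub, one_mul, ← zpow_add₀ hq] <;>
    ring_nf
end
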